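/- arXiv:1906.02319 — 3 statements merged into one kernel-verified Lean document; each statement's English description precedes it below -/
import Mathlib

section
/- Let G = (V, E) be a finite simple graph with neighborhood N(v) for each node v, let C be a type of initial colors and c^0 : V → C an initial coloring, and define the Weisfeiler-Lehman colorings recursively by c^{k+1}(v) = (c^k(v), multiset of c^k(u) over u ∈ N(v)). Let H be a type, let g : C → H be injective, let f : H × Multiset H → H be injective, and define GNN features recursively by h^0(v) = g(c^0(v)) and h^{k+1}(v) = f(h^k(v), multiset of h^k(u) over u ∈ N(v)). Then for every k ≥ 0 and every pair of nodes u, v ∈ V: h^k(u) = h^k(v) if and only if c^k(u) = c^k(v). In other words, the learned features of two nodes differ exactly when the k-round Weisfeiler-Lehman test assigns them different colors. -/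
/-- The type of Weisfeiler-Lehman colors after `k` rounds, starting from
initial colors in `C`: a round-`(k+1)` color is a pair of a round-`k` color
and a multiset of round-`k` colors. -/
def WLColorType (C : Type) : ℕ → Type
  | 0 => C
  | k + 1 => WLColorType C k × Multiset (WLColorType C k)

/-- The Weisfeiler-Lehman coloring of a finite simple graph `G` after `k`
rounds: `c^{k+1}(v) = (c^k(v), {{ c^k(u) : u ∈ N(v) }})`. -/
def wlColoring {V : Type} [Fintype V] (G : SimpleGraph V) [DecidableRel G.Adj]
    {C : Type} (c0 : V → C) : (k : ℕ) → V → WLColorType C k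
  | 0 => c0
  | k + 1 => fun v =>
      (wlColoring G c0 k v, (G.neighborFinset v).val.map (wlColoring G c0 k))

/-- The GNN features with initial feature map `g` and aggregation function `f`:
`h^0(v) = g(c^0(v))` and `h^{k+1}(v) = f(h^k(v), {{ h^k(u) : u ∈ N(v) }})`. -/
def gnnFeature {V : Type} [Fintype V] (G : SimpleGraph V) [DecidableRel G.Adj]
    {C H : Type} (c0 : V → C) (g : C → H) (f : H × Multiset H → H) :
    ℕ → V → H
  | 0 => fun v => g (c0 v)
  | k + 1 => fun v =>
      f (gnnFeature G c0 g f k v, (G.neighborFinset v).val.map (gnnFeature G c0 g f k))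

/-- The map from WL colors to features induced by `g` and `f`. -/
def wlToFeature {C H : Type} (g : C → H) (f : H × Multiset H → H) :
    (k : ℕ) → WLColorType C k → H
  | 0 => g
  | k + 1 => fun p => f (wlToFeature g f k p.1, p.2.map (wlToFeature g f k))

theorem wlToFeature_injective {C H : Type} (g : C → H) (f : H × Multiset H → H)
    (hg : Function.Injective g) (hf : Function.Injective f) :
    ∀ k, Function.Injective (wlToFeature g f k) := by
  intro k
  induction k with
  | zero => exact hg
  | succ k ih =>
    intro p q h
    have h2 := Prod.mk.inj (hf h)
    exact Prod.ext (ih h2.1) (Multiset.map_injective ih h2.2)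

theorem gnnFeature_eq_wlToFeature {V : Type} [Fintype V] (G : SimpleGraph V)
    [DecidableRel G.Adj] {C H : Type} (c0 : V → C) (g : C → H)
    (f : H × Multiset H → H) :
    ∀ k, gnnFeature G c0 g f k = wlToFeature g f k ∘ wlColoring G c0 k := by
  intro k
  induction k with
  | zero => rfl
  | succ k ih =>
    funext v
    simp only [gnnFeature, ih, Function.comp, wlToFeature, wlColoring, Multiset.map_map]

/-- **Lemma 4.1.** If the initial feature map `g` and the aggregation function
`f` of a graph neural network are injective, then for every round `k` and all
nodes `u, v`, the learned features agree iff the `k`-round Weisfeiler-Lehman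
colors agree: the GNN distinguishes nodes exactly as well as the WL test. -/
theorem gnn_injective_iff_wl
    {V : Type} [Fintype V] (G : SimpleGraph V) [DecidableRel G.Adj]
    {C H : Type} (c0 : V → C) (g : C → H) (f : H × Multiset H → H)
    (hg : Function.Injective g) (hf : Function.Injective f) :
    ∀ (k : ℕ) (u v : V),
      gnnFeature G c0 g f k u = gnnFeature G c0 g f k v ↔
        wlColoring G c0 k u = wlColoring G c0 k v := by
  intro k u v
  rw [gnnFeature_eq_wlToFeature]
  exact (wlToFeature_injective g f hg hf k).eq_iff
end

section
/- Let G = (V, E) be a finite simple graph with neighborhood N(v) for each node v, let C be a type of initial colors and c^0 : V → C an initial coloring, and define the Weisfeiler-Lehman colorings recursively by c^{k+1}(v) = (c^k(v), multiset of c^k(u) over u ∈ N(v)). Let H be a type, let g : C → H be any function, let f : H × Multiset H → H be any (not necessarily injective) aggregation function, and define GNN features recursively by h^0(v) = g(c^0(v)) and h^{k+1}(v) = f(h^k(v), multiset of h^k(u) over u ∈ N(v)). Then for every k ≥ 0 and every pair of nodes u, v ∈ V: if c^k(u) = c^k(v) then h^k(u) = h^k(v). That is, a graph neural network with any aggregation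 function is at most as powerful as the Weisfeiler-Lehman test in distinguishing nodes. -/
/-- Decode a WL color into the corresponding GNN feature. -/
def wlDecode {C H : Type} (g : C → H) (f : H × Multiset H → H) :
    (k : ℕ) → WLColorType C k → H
  | 0 => fun c => g c
  | k + 1 => fun c => f (wlDecode g f k c.1, c.2.map (wlDecode g f k))

lemma gnnFeature_eq_wlDecode
    {V : Type} [Fintype V] (G : SimpleGraph V) [DecidableRel G.Adj]
    {C H : Type} (c0 : V → C) (g : C → H) (f : H × Multiset H → H) (k : ℕ) :
    gnnFeature G c0 g f k = fun v => wlDecode g f k (wlColoring G c0 k v) := by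
  induction k with
  | zero => rfl
  | succ k ih =>
    funext v
    simp only [gnnFeature, wlDecode, wlColoring, ih, Multiset.map_map, Function.comp_def]

/-- **GNNs are at most as powerful as the WL test.** For arbitrary (not
necessarily injective) initial feature map `g` and aggregation function `f`,
if two nodes get the same `k`-round Weisfeiler-Lehman color then they get the
same `k`-round GNN feature. -/
theorem gnn_le_wl
    {V : Type} [Fintype V] (G : SimpleGraph V) [DecidableRel G.Adj]
    {C H : Type} (c0 : V → C) (g : C → H) (f : H × Multiset H → H) :
    ∀ (k : ℕ) (u v : V),
      wlColoring G c0 k u = wlColoring G c0 k v →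
        gnnFeature G c0 g f k u = gnnFeature G c0 g f k v := by
  intro k u v h
  simp only [gnnFeature_eq_wlDecode, h]
end

section
/- Fix n, m ≥ 1 and a hash function ξ₁ : Fin n → Fin m. Let ξ₂ = (ξ₂(1), …, ξ₂(n)) be independent random signs, each uniformly distributed on {−1, +1}. For x ∈ ℝ^n define the hashed vector φ(x) ∈ ℝ^m by φ_i(x) = Σ_{j : ξ₁(j) = i} ξ₂(j) · x_j. Then for all x, x' ∈ ℝ^n, the hash kernel is unbiased: E_{ξ₂}[⟨φ(x), φ(x')⟩] = ⟨x, x'⟩, where ⟨·,·⟩ denotes the Euclidean inner product. -/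
open Finset

theorem sign_corr (n : ℕ) (j k : Fin n) :
    ∑ ε : Fin n → Bool, (if ε j then (1 : ℝ) else -1) * (if ε k then (1 : ℝ) else -1)
      = if j = k then 2 ^ n else 0 := by
  split_ifs with h
  · subst h
    have : ∀ ε : Fin n → Bool,
        (if ε j then (1 : ℝ) else -1) * (if ε j then (1 : ℝ) else -1) = 1 := by
      intro ε
      split_ifs <;> norm_num
    simp only [this]
    simp
  · have hinv : Function.Involutive
        (fun ε : Fin n → Bool => Function.update ε j (!ε j)) := by
      intro ε
      simp
    have e := Equiv.sum_comp (hinv.toPerm _)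
      (fun ε : Fin n → Bool => (if ε j then (1 : ℝ) else -1) * (if ε k then (1 : ℝ) else -1))
    have e2 : ∀ ε : Fin n → Bool,
        (if ((hinv.toPerm _ : Equiv.Perm (Fin n → Bool)) ε) j then (1 : ℝ) else -1) * (if ((hinv.toPerm _ : Equiv.Perm (Fin n → Bool)) ε) k then (1 : ℝ) else -1)
        = -((if ε j then (1 : ℝ) else -1) * (if ε k then (1 : ℝ) else -1)) := by
      intro ε
      have hk : k ≠ j := fun h' => h h'.symm
      simp only [Function.Involutive.coe_toPerm, Function.update_self,
        Function.update_of_ne hk]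
      cases ε j <;> cases ε k <;> simp
    simp only [e2, Finset.sum_neg_distrib] at e
    linarith

/-- **Unbiasedness of the hash kernel (after Eq. (9)).**
Fix `n, m ≥ 1` and a bucket hash `ξ₁ : Fin n → Fin m`. Let the signs
`ξ₂(1), …, ξ₂(n)` be independent and uniform on `{-1, +1}` — i.e. average over
all `2^n` sign patterns `ε : Fin n → Bool` with equal weight `1/2^n`, where the
sign of coordinate `j` is `1` if `ε j` else `-1`. With the hashed vector
`φ_i(x) = Σ_{j : ξ₁(j) = i} ξ₂(j)·x_j`, the expected inner product
`E[⟨φ(x), φ(x')⟩]` equals the Euclidean inner product `⟨x, x'⟩`. -/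
theorem hash_kernel_unbiased
    (n m : ℕ) (hn : 1 ≤ n) (hm : 1 ≤ m) (ξ₁ : Fin n → Fin m)
    (x x' : Fin n → ℝ) :
    (1 / 2 ^ n : ℝ) *
      ∑ ε : Fin n → Bool,
        ∑ i : Fin m,
          (∑ j ∈ univ.filter (fun j => ξ₁ j = i),
              (if ε j then (1 : ℝ) else -1) * x j) *
          (∑ j ∈ univ.filter (fun j => ξ₁ j = i),
              (if ε j then (1 : ℝ) else -1) * x' j)
      = ∑ j : Fin n, x j * x' j := by
  rw [Finset.sum_comm]
  have key : ∀ i : Fin m, ∑ ε : Fin n → Bool,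
          (∑ j ∈ univ.filter (fun j => ξ₁ j = i),
              (if ε j then (1 : ℝ) else -1) * x j) *
          (∑ j ∈ univ.filter (fun j => ξ₁ j = i),
              (if ε j then (1 : ℝ) else -1) * x' j)
      = ∑ j ∈ univ.filter (fun j => ξ₁ j = i), 2 ^ n * (x j * x' j) := by
    intro i
    simp only [Finset.sum_mul_sum]
    rw [Finset.sum_comm]
    refine Finset.sum_congr rfl fun j hj => ?_
    rw [Finset.sum_comm]
    have : ∀ k : Fin n, ∑ ε : Fin n → Bool,
        (if ε j then (1 : ℝ) else -1) * x j * ((if ε k then (1 : ℝ) else -1) * x' k)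
        = if j = k then 2 ^ n * (x j * x' k) else 0 := by
      intro k
      simp only [mul_mul_mul_comm _ (x j)]
      rw [← Finset.sum_mul, sign_corr]
      split_ifs <;> simp
    simp only [this]
    rw [Finset.sum_ite_eq, if_pos hj]
  simp only [key]
  rw [Finset.sum_fiberwise, ← Finset.mul_sum, ← mul_assoc]
  simp
end
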